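/- Let λ > 0, c₁ > 0, c₂ > 0, p > 2 real, and 0 ≤ s < t. Let K : ℝ × ℝ × (0, ∞) → ℝ be measurable with |K(x, y, τ)| ≤ c₁ · τ^{−1} · exp(−c₂(x − y)²/τ) for all x, y, τ, and let h : (0, λ) × (s, t) → ℝ be measurable such that r ↦ sup_{y ∈ (0,λ)} |h(y, r)| is in L^p(s, t). Then for every x ∈ ℝ, (∫_s^t ∫_0^λ |K(x, y, t − r)| · |h(y, r)| dy dr)^p ≤ (c₁ √(π/c₂))^p · (2(p − 1)/(p − 2))^{p−1} · (t − s)^{(p−2)/2} · ∫_s^t (sup_{y ∈ (0,λ)} |h(y, r)|)^p dr. -/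

import Mathlib

open MeasureTheory Real

/-- The Gaussian profile `τ⁻¹ exp (-c (x - y)² / τ)` has total mass `√(π / c) τ^(-1/2)`. -/
lemma integral_inv_mul_exp_neg_mul_sq_div (c x : ℝ) {τ : ℝ} (hτ : 0 < τ) :
    ∫ y, τ⁻¹ * Real.exp (-c * (x - y) ^ 2 / τ) = √(π / c) * τ ^ (-(1 / 2) : ℝ) := by
  have hshift : ∫ y, Real.exp (-c * (x - y) ^ 2 / τ) = ∫ y, Real.exp (-(c / τ) * y ^ 2) := by
    rw [← integral_sub_left_eq_self (fun y => Real.exp (-(c / τ) * y ^ 2)) volume x]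
    congr with y
    ring_nf
  have hsqrt : √(π / (c / τ)) = √(π / c) * √τ := by
    rw [← Real.sqrt_mul' _ hτ.le]
    congr 1
    rw [div_div_eq_mul_div, div_mul_eq_mul_div]
  have hpow : τ⁻¹ * √τ = τ ^ (-(1 / 2) : ℝ) := by
    rw [Real.sqrt_eq_rpow, ← Real.rpow_neg_one, ← Real.rpow_add hτ]
    norm_num
  rw [integral_const_mul, hshift, integral_gaussian, hsqrt, ← hpow]
  ring

lemma integrable_inv_mul_exp_neg_mul_sq_div {c : ℝ} (hc : 0 < c) (x : ℝ) {τ : ℝ} (hτ : 0 < τ) :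
    Integrable fun y => τ⁻¹ * Real.exp (-c * (x - y) ^ 2 / τ) := by
  have hg := ((integrable_exp_neg_mul_sq (div_pos hc hτ)).comp_sub_left x).const_mul τ⁻¹
  convert hg using 4
  ring

/-- A kernel dominated by a Gaussian profile, integrated against a function bounded by `M`. -/
lemma setIntegral_mul_le_of_gaussian_bound {c₁ c₂ x τ M : ℝ} {S : Set ℝ} {k f : ℝ → ℝ}
    (hS : MeasurableSet S) (hc₁ : 0 ≤ c₁) (hc₂ : 0 < c₂) (hτ : 0 < τ) (hM : 0 ≤ M)
    (hk : ∀ y, |k y| ≤ c₁ * τ⁻¹ * Real.exp (-c₂ * (x - y) ^ 2 / τ))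
    (hf : ∀ y ∈ S, |f y| ≤ M) :
    ∫ y in S, |k y| * |f y| ≤ c₁ * √(π / c₂) * (M * τ ^ (-(1 / 2) : ℝ)) := by
  have hint : Integrable fun y => c₁ * M * (τ⁻¹ * Real.exp (-c₂ * (x - y) ^ 2 / τ)) :=
    (integrable_inv_mul_exp_neg_mul_sq_div hc₂ x hτ).const_mul _
  calc ∫ y in S, |k y| * |f y|
      ≤ ∫ y in S, c₁ * M * (τ⁻¹ * Real.exp (-c₂ * (x - y) ^ 2 / τ)) := by
        refine integral_mono_of_nonneg (.of_forall fun y => by positivity) hint.integrableOn ?_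
        filter_upwards [ae_restrict_mem hS] with y hy
        calc |k y| * |f y| ≤ (c₁ * τ⁻¹ * Real.exp (-c₂ * (x - y) ^ 2 / τ)) * M :=
              mul_le_mul (hk y) (hf y hy) (abs_nonneg _) (by positivity)
          _ = _ := by ring
    _ ≤ ∫ y, c₁ * M * (τ⁻¹ * Real.exp (-c₂ * (x - y) ^ 2 / τ)) :=
        setIntegral_le_integral hint (.of_forall fun y => by positivity)
    _ = _ := by
        rw [integral_const_mul, integral_inv_mul_exp_neg_mul_sq_div c₂ x hτ]
        ring

lemma integrableOn_Ioc_sub_rpow {s t a : ℝ} (hst : s ≤ t) (ha : -1 < a) :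
    IntegrableOn (fun r => (t - r) ^ a) (Set.Ioc s t) := by
  rw [← intervalIntegrable_iff_integrableOn_Ioc_of_le hst]
  simpa using (intervalIntegral.intervalIntegrable_rpow' (a := t - s) (b := 0) ha).comp_sub_left t

lemma setIntegral_Ioc_sub_rpow {s t a : ℝ} (hst : s ≤ t) (ha : -1 < a) :
    ∫ r in Set.Ioc s t, (t - r) ^ a = (t - s) ^ (a + 1) / (a + 1) := by
  rw [← intervalIntegral.integral_of_le hst,
    intervalIntegral.integral_comp_sub_left (fun r => r ^ a), sub_self, integral_rpow (.inl ha),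
    Real.zero_rpow (by linarith), sub_zero]

/-- A nonnegative function with integrable `p`-th power belongs to `L^p`. -/
lemma memLp_of_integrable_rpow {α : Type*} [MeasurableSpace α] {μ : Measure α} {f : α → ℝ}
    {p : ℝ} (hp : 0 < p) (hf : ∀ a, 0 ≤ f a) (hfp : Integrable (fun a => f a ^ p) μ) :
    MemLp f (ENNReal.ofReal p) μ := by
  have hroot : f = fun a => (f a ^ p) ^ p⁻¹ := by
    ext a
    rw [Real.rpow_rpow_inv (hf a) hp.ne']
  have hmeas : AEStronglyMeasurable f μ := by
    rw [hroot]
    exact (hfp.aemeasurable.pow_const _).aestronglyMeasurable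
  rw [← integrable_norm_rpow_iff hmeas (by simpa using hp) ENNReal.ofReal_ne_top,
    ENNReal.toReal_ofReal hp.le]
  simpa only [Real.norm_of_nonneg (hf _)] using hfp

/-- Hölder's bound for convolution with the singular kernel `(t - r)^(-1/2)`. -/
lemma integrableOn_and_rpow_setIntegral_mul_sub_rpow_le {s t p : ℝ} {M : ℝ → ℝ} (hst : s < t)
    (hp : 2 < p) (hM : ∀ r, 0 ≤ M r) (hMp : IntegrableOn (fun r => M r ^ p) (Set.Ioc s t)) :
    IntegrableOn (fun r => M r * (t - r) ^ (-(1 / 2) : ℝ)) (Set.Ioc s t) ∧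
    (∫ r in Set.Ioc s t, M r * (t - r) ^ (-(1 / 2) : ℝ)) ^ p ≤
      (2 * (p - 1) / (p - 2)) ^ (p - 1) * (t - s) ^ ((p - 2) / 2) *
        ∫ r in Set.Ioc s t, M r ^ p := by
  set q := p / (p - 1) with hq
  have hp1 : 0 < p - 1 := by linarith
  have hp2 : 0 < p - 2 := by linarith
  have hpq : p.HolderConjugate q := Real.HolderConjugate.conjExponent (by linarith)
  have hexp : -(1 / 2) * q + 1 = (p - 2) / (2 * (p - 1)) := by
    rw [hq]
    field_simp
    ring
  have hexp' : -1 < -(1 / 2) * q := by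
    have : 0 < (p - 2) / (2 * (p - 1)) := by positivity
    linarith
  let w : ℝ → ℝ := fun r => |t - r| ^ (-(1 / 2) : ℝ)
  have hw : ∀ r, 0 ≤ w r := fun r => by positivity
  have hweq : ∀ r ∈ Set.Ioc s t, w r = (t - r) ^ (-(1 / 2) : ℝ) := fun r hr => by
    simp only [w, abs_of_nonneg (sub_nonneg.2 hr.2)]
  have hwq : ∀ r ∈ Set.Ioc s t, w r ^ q = (t - r) ^ (-(1 / 2) * q) := fun r hr => by
    rw [hweq r hr, ← Real.rpow_mul (sub_nonneg.2 hr.2)]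
  have hMLp := memLp_of_integrable_rpow hpq.pos hM hMp
  have hwLq : MemLp w (ENNReal.ofReal q) (volume.restrict (Set.Ioc s t)) :=
    memLp_of_integrable_rpow hpq.symm.pos hw
      ((integrableOn_Ioc_sub_rpow hst.le hexp').congr_fun (fun r hr => (hwq r hr).symm)
        measurableSet_Ioc)
  have hMw : ∀ r ∈ Set.Ioc s t, M r * w r = M r * (t - r) ^ (-(1 / 2) : ℝ) := fun r hr => by
    rw [hweq r hr]
  constructor
  · have := hpq.ennrealOfReal
    exact IntegrableOn.congr_fun (hMLp.integrable_mul hwLq) hMw measurableSet_Ioc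
  have hI : 0 ≤ ∫ r in Set.Ioc s t, M r ^ p :=
    integral_nonneg fun r => Real.rpow_nonneg (hM r) p
  have hholder := integral_mul_le_Lp_mul_Lq_of_nonneg hpq (.of_forall hM) (.of_forall hw)
    hMLp hwLq
  rw [setIntegral_congr_fun measurableSet_Ioc hMw, setIntegral_congr_fun measurableSet_Ioc hwq,
    setIntegral_Ioc_sub_rpow hst.le hexp', hexp] at hholder
  have hts : 0 < t - s := sub_pos.2 hst
  have hleft : 0 ≤ ∫ r in Set.Ioc s t, M r * (t - r) ^ (-(1 / 2) : ℝ) :=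
    setIntegral_nonneg measurableSet_Ioc fun r hr =>
      mul_nonneg (hM r) (Real.rpow_nonneg (sub_nonneg.2 hr.2) _)
  refine (Real.rpow_le_rpow hleft hholder hpq.pos.le).trans_eq ?_
  have hpq' : 1 / q * p = p - 1 := by
    rw [hq]
    field_simp
  rw [Real.mul_rpow (by positivity) (by positivity), ← Real.rpow_mul hI,
    ← Real.rpow_mul (by positivity), one_div_mul_cancel hpq.ne_zero, Real.rpow_one, hpq',
    div_eq_mul_inv, inv_div, Real.mul_rpow (by positivity) (by positivity),
    ← Real.rpow_mul hts.le]
  have : (p - 2) / (2 * (p - 1)) * (p - 1) = (p - 2) / 2 := by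
    field_simp
  rw [this]
  ring

/-- Combined estimate for the space-time convolution of the heat-kernel
derivative bound with an integrand `h`:
`(∫_s^t ∫_0^λ |K(x,y,t-r)| |h(y,r)| dy dr)^p ≤
  (c₁√(π/c₂))^p (2(p-1)/(p-2))^{p-1} (t-s)^{(p-2)/2} ∫_s^t (sup_y |h(y,r)|)^p dr`. -/
theorem kernel_derivative_convolution_bound (lam c₁ c₂ p s t : ℝ)
    (hlam : 0 < lam) (hc₁ : 0 < c₁) (hc₂ : 0 < c₂) (hp : 2 < p)
    (hs : 0 ≤ s) (hst : s < t)
    (K : ℝ → ℝ → ℝ → ℝ) (hK : Measurable fun q : ℝ × ℝ × ℝ => K q.1 q.2.1 q.2.2)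
    (hKb : ∀ x y τ : ℝ, 0 < τ → |K x y τ| ≤ c₁ * τ⁻¹ * Real.exp (-c₂ * (x - y) ^ 2 / τ))
    (h : ℝ → ℝ → ℝ) (hh : Measurable fun q : ℝ × ℝ => h q.1 q.2)
    (hbdd : ∀ r ∈ Set.Ioc s t, BddAbove (Set.range fun y : Set.Ioo (0:ℝ) lam => |h y r|))
    (hhp : IntegrableOn (fun r => (⨆ y : Set.Ioo (0:ℝ) lam, |h y r|) ^ p) (Set.Ioc s t)) :
    ∀ x : ℝ,
      (∫ r in Set.Ioc s t, ∫ y in Set.Ioo (0:ℝ) lam, |K x y (t - r)| * |h y r|) ^ p ≤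
        (c₁ * Real.sqrt (Real.pi / c₂)) ^ p * (2 * (p - 1) / (p - 2)) ^ (p - 1) *
          (t - s) ^ ((p - 2) / 2) *
            ∫ r in Set.Ioc s t, (⨆ y : Set.Ioo (0:ℝ) lam, |h y r|) ^ p := by
  intro x
  set M : ℝ → ℝ := fun r => ⨆ y : Set.Ioo (0:ℝ) lam, |h y r|
  have hM : ∀ r, 0 ≤ M r := fun r => Real.iSup_nonneg fun y => abs_nonneg _
  obtain ⟨hint, hholder⟩ :=
    integrableOn_and_rpow_setIntegral_mul_sub_rpow_le hst hp hM hhp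
  have hmono : ∫ r in Set.Ioc s t, ∫ y in Set.Ioo (0:ℝ) lam, |K x y (t - r)| * |h y r| ≤
      c₁ * √(π / c₂) * ∫ r in Set.Ioc s t, M r * (t - r) ^ (-(1 / 2) : ℝ) := by
    rw [← integral_const_mul]
    refine integral_mono_of_nonneg
      (.of_forall fun r => integral_nonneg fun y => by positivity) (hint.const_mul _) ?_
    filter_upwards [ae_restrict_mem measurableSet_Ioc,
      ae_restrict_of_ae (Measure.ae_ne volume t)] with r hr hrt
    have hτ : 0 < t - r := sub_pos.2 (hr.2.lt_of_ne hrt)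
    exact setIntegral_mul_le_of_gaussian_bound measurableSet_Ioo hc₁.le hc₂ hτ (hM r)
      (fun y => hKb x y _ hτ) fun y hy => le_ciSup (hbdd r hr) ⟨y, hy⟩
  have hnonneg : 0 ≤ ∫ r in Set.Ioc s t, M r * (t - r) ^ (-(1 / 2) : ℝ) :=
    setIntegral_nonneg measurableSet_Ioc fun r hr =>
      mul_nonneg (hM r) (Real.rpow_nonneg (sub_nonneg.2 hr.2) _)
  calc _ ≤ (c₁ * √(π / c₂) * ∫ r in Set.Ioc s t, M r * (t - r) ^ (-(1 / 2) : ℝ)) ^ p :=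
        Real.rpow_le_rpow (integral_nonneg fun r => integral_nonneg fun y => by positivity)
          hmono (by linarith)
    _ = (c₁ * √(π / c₂)) ^ p * (∫ r in Set.Ioc s t, M r * (t - r) ^ (-(1 / 2) : ℝ)) ^ p :=
        Real.mul_rpow (by positivity) hnonneg
    _ ≤ _ := mul_le_mul_of_nonneg_left hholder (by positivity)
    _ = _ := by simp only [M, mul_assoc]
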